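/- arXiv:1709.09584 — 2 statements merged into one kernel-verified Lean document; each statement's English description precedes it below -/
import Mathlib

section
/- Let Γ be an infinite set, X a complex Banach space, and Δ : S(ℓ∞(Γ)) → S(X) a surjective isometry. If v_1,...,v_k are mutually orthogonal nonzero partial isometries in ℓ∞(Γ), then {Δ(v_1),...,Δ(v_k)} is a completely M-orthogonal subset of S(X): ‖∑ α_j Δ(v_j)‖ = max_j |α_j| for all α_j ∈ ℂ. -/
open scoped ENNReal

/-- If `‖d + z‖ = 2` for vectors `d`, `z` of norm one, the segment from `z` to `d` lies in the
unit sphere. -/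
theorem norm_eq_one_of_mem_segment {X : Type*} [NormedAddCommGroup X] [NormedSpace ℝ X]
    {d z w : X} (hd : ‖d‖ = 1) (hz : ‖z‖ = 1) (hdz : ‖d + z‖ = 2) (hw : w ∈ segment ℝ z d) :
    ‖w‖ = 1 := by
  obtain ⟨a, b, ha, hb, hab, rfl⟩ := hw
  have bound : ∀ r s : ℝ, 0 ≤ r → 0 ≤ s → r + s = 1 → ‖r • z + s • d‖ ≤ 1 := by
    intro r s hr hs hrs
    calc ‖r • z + s • d‖ ≤ ‖r • z‖ + ‖s • d‖ := norm_add_le _ _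
      _ = 1 := by rw [norm_smul_of_nonneg hr, norm_smul_of_nonneg hs, hd, hz]; linarith
  refine le_antisymm (bound a b ha hb hab) ?_
  have hsum : d + z = (a • z + b • d) + (b • z + a • d) := by
    obtain rfl : b = 1 - a := by linarith
    module
  have h1 := norm_add_le (a • z + b • d) (b • z + a • d)
  have h2 := bound b a hb ha (by linarith)
  rw [← hsum, hdz] at h1
  linarith

/-- For every unit vector `p`, the unit sphere has a convex subset `D` whose points are all at
distance two from `-p`, and which contains every unit vector at distance two from all points of
`-D`: a maximal convex subset of the sphere through `p`. -/
theorem exists_convex_subset_sphere {X : Type*} [NormedAddCommGroup X] [NormedSpace ℝ X]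
    {p : X} (hp : ‖p‖ = 1) :
    ∃ D : Set X, Convex ℝ D ∧ (∀ d ∈ D, ‖d‖ = 1) ∧
      (∀ d ∈ D, ‖d + p‖ = 2) ∧ ∀ z, ‖z‖ = 1 → (∀ d ∈ D, ‖d + z‖ = 2) → z ∈ D := by
  obtain ⟨D, hpD, hD⟩ := zorn_subset_nonempty {D : Set X | Convex ℝ D ∧ ∀ d ∈ D, ‖d‖ = 1}
    (fun c hc hchain _ => ⟨⋃₀ c,
      ⟨hchain.directedOn.convex_sUnion fun A hA => (hc hA).1,
        fun d ⟨A, hA, hdA⟩ => (hc hA).2 d hdA⟩,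
      fun s hs => Set.subset_sUnion_of_mem hs⟩)
    {p} ⟨convex_singleton p, by simpa using hp⟩
  have hpD : p ∈ D := hpD rfl
  refine ⟨D, hD.prop.1, hD.prop.2, fun d hd => ?_, fun z hz hzD => ?_⟩
  · have h := hD.prop.2 _ (hD.prop.1 hd hpD (by norm_num : (0 : ℝ) ≤ 1 / 2)
      (by norm_num : (0 : ℝ) ≤ 1 / 2) (by norm_num))
    rw [← smul_add, norm_smul_of_nonneg (by norm_num)] at h
    linarith
  · refine hD.le_of_ge (y := convexJoin ℝ {z} D)
      ⟨(convex_singleton z).convexJoin hD.prop.1, fun w hw => ?_⟩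
      (subset_convexJoin_right (Set.singleton_nonempty z))
      (subset_convexJoin_left ⟨p, hpD⟩ rfl)
    obtain ⟨_, rfl, d, hd, hwd⟩ := mem_convexJoin.1 hw
    exact norm_eq_one_of_mem_segment (hD.prop.2 d hd) hz (hzD d hd) hwd

/-- A convex subset of the complex unit sphere is normed by a single functional. -/
theorem exists_dual_eq_one_of_convex {X : Type*} [NormedAddCommGroup X] [NormedSpace ℂ X]
    {D : Set X} (hD : Convex ℝ D) (h1 : ∀ d ∈ D, ‖d‖ = 1) :
    ∃ φ : X →ₗ[ℂ] ℂ, (∀ y, ‖φ y‖ ≤ ‖y‖) ∧ ∀ d ∈ D, φ d = 1 := by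
  obtain ⟨f, u, hball, hfD⟩ := RCLike.geometric_hahn_banach_open (𝕜 := ℂ)
    (convex_ball (0 : X) 1) Metric.isOpen_ball hD
    (Set.disjoint_left.2 fun x hx hxD => by
      rw [mem_ball_zero_iff, h1 x hxD] at hx
      exact lt_irrefl _ hx)
  have hu : 0 < u := by simpa using hball 0 (by simp)
  have hre : ∀ y, (f y).re ≤ u * ‖y‖ := by
    intro y
    refine le_of_forall_pos_le_add fun ε hε => ?_
    set r : ℝ := ‖y‖ + ε / u with hr
    have hr0 : 0 < r := by positivity
    have h := hball (((r⁻¹ : ℝ) : ℂ) • y) (by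
      rw [mem_ball_zero_iff, norm_smul, Complex.norm_real, Real.norm_of_nonneg (by positivity),
        inv_mul_lt_one₀ hr0, hr]
      have : 0 < ε / u := by positivity
      linarith)
    rw [map_smul, smul_eq_mul] at h
    have h : r⁻¹ * (f y).re < u := by simpa using h
    rw [inv_mul_lt_iff₀ hr0] at h
    have : r * u = u * ‖y‖ + ε := by rw [hr]; field_simp
    linarith
  have hnorm : ∀ y, ‖f y‖ ≤ u * ‖y‖ := by
    intro y
    rcases eq_or_ne (f y) 0 with h0 | h0
    · rw [h0, norm_zero]; positivity
    have hn : (‖f y‖ : ℂ) ≠ 0 := by simpa using h0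
    have h := hre ((starRingEnd ℂ (f y) / ‖f y‖) • y)
    rw [map_smul, norm_smul, smul_eq_mul, norm_div, RCLike.norm_conj, Complex.norm_real,
      norm_norm, div_self (by simpa using h0), one_mul, div_mul_eq_mul_div,
      Complex.conj_mul', sq, mul_div_assoc, div_self hn, mul_one, Complex.ofReal_re] at h
    exact h
  refine ⟨((u⁻¹ : ℝ) : ℂ) • f.toLinearMap, fun y => ?_, fun d hd => ?_⟩
  · have := hnorm y
    simp only [LinearMap.smul_apply, ContinuousLinearMap.coe_coe, norm_smul, Complex.norm_real,
      Real.norm_of_nonneg (inv_nonneg.2 hu.le)]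
    rwa [inv_mul_le_iff₀ hu]
  · have h2 : u ≤ (f d).re := hfD d hd
    have h3 := hnorm d
    rw [h1 d hd, mul_one] at h3
    have h4 : (f d).re = ‖f d‖ := le_antisymm (Complex.re_le_norm _) (by linarith)
    have h5 : f d = (u : ℂ) := by
      have h6 : (f d).re = u := le_antisymm (by linarith) h2
      have h7 := Complex.sq_norm (f d)
      rw [Complex.normSq_apply, ← h4] at h7
      have h8 : (f d).im = 0 := by nlinarith
      exact Complex.ext h6 (by simpa using h8)
    have : (u : ℂ) ≠ 0 := by exact_mod_cast hu.ne'
    simp [h5, this]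

namespace lp

variable {Γ : Type*}

/-- Changing one coordinate of an element of the unit ball to a number of modulus one gives an
element of the unit sphere. -/
theorem exists_mem_sphere_apply_eq {x : lp (fun _ : Γ => ℂ) ∞} (hx : ‖x‖ ≤ 1) (t : Γ) {c : ℂ}
    (hc : ‖c‖ = 1) :
    ∃ y : Metric.sphere (0 : lp (fun _ : Γ => ℂ) ∞) 1,
      (y : lp (fun _ : Γ => ℂ) ∞) t = c ∧
        ‖(y : lp (fun _ : Γ => ℂ) ∞) - x‖ = ‖c - x t‖ := by
  classical
  have ht : (x + lp.single ∞ t (c - x t) : lp (fun _ : Γ => ℂ) ∞) t = c := by simp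
  refine ⟨⟨x + lp.single ∞ t (c - x t), ?_⟩, ht, ?_⟩
  · rw [mem_sphere_zero_iff_norm]
    refine le_antisymm (lp.norm_le_of_forall_le zero_le_one fun s => ?_) ?_
    · rcases eq_or_ne s t with rfl | hs
      · rw [ht, hc]
      · simpa [hs] using (lp.norm_apply_le_norm ENNReal.top_ne_zero x s).trans hx
    · have h := lp.norm_apply_le_norm ENNReal.top_ne_zero (x + lp.single ∞ t (c - x t)) t
      rwa [ht, hc] at h
  · rw [add_sub_cancel_left, lp.norm_single (by simp)]

/-- The elements of the unit sphere at distance two from the point mass `-c` at `t` have value `c`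
at `t`. -/
theorem apply_eq_of_norm_sub_single [DecidableEq Γ] {x : lp (fun _ : Γ => ℂ) ∞} (hx : ‖x‖ ≤ 1)
    {t : Γ} {c : ℂ} (hc : ‖c‖ = 1) (h : ‖x - lp.single ∞ t (-c)‖ = 2) : x t = c := by
  have hxt := (lp.norm_apply_le_norm ENNReal.top_ne_zero x t).trans hx
  have h2 : 2 ≤ ‖x t + c‖ := by
    by_contra! hlt
    have : ‖x - lp.single ∞ t (-c)‖ ≤ max 1 ‖x t + c‖ := by
      refine lp.norm_le_of_forall_le (by positivity) fun s => ?_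
      rcases eq_or_ne s t with rfl | hs
      · simp
      · refine le_max_of_le_left ?_
        simpa [hs] using (lp.norm_apply_le_norm ENNReal.top_ne_zero x s).trans hx
    rw [h] at this
    exact absurd this (not_le.2 (max_lt one_lt_two hlt))
  have h3 := parallelogram_law_with_norm ℝ (x t) c
  have h4 : ‖x t - c‖ = 0 := by
    have := norm_nonneg (x t)
    rw [hc] at h3
    exact pow_eq_zero_iff two_ne_zero |>.1 (le_antisymm (by nlinarith) (sq_nonneg _))
  exact sub_eq_zero.1 (norm_eq_zero.1 h4)

end lp

section SphereIsometry

variable {Γ X : Type*} [NormedAddCommGroup X] [NormedSpace ℂ X]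
  {Δ : Metric.sphere (0 : lp (fun _ : Γ => ℂ) ∞) 1 → Metric.sphere (0 : X) 1}

/-- For a surjective isometry `Δ` between unit spheres, some convex subset of the sphere of `X`
lies between the antipode of the image of the face `{x | x t = -c}` and the image of the face
`{x | x t = c}`. -/
theorem exists_convex_between_faces (hsurj : Function.Surjective Δ)
    (hiso : ∀ u v, ‖(Δ u : X) - (Δ v : X)‖ =
      ‖(u : lp (fun _ : Γ => ℂ) ∞) - (v : lp (fun _ : Γ => ℂ) ∞)‖)
    (t : Γ) {c : ℂ} (hc : ‖c‖ = 1) :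
    ∃ D : Set X, Convex ℝ D ∧ (∀ d ∈ D, ‖d‖ = 1) ∧
      (∀ x : Metric.sphere (0 : lp (fun _ : Γ => ℂ) ∞) 1,
        (x : lp (fun _ : Γ => ℂ) ∞) t = -c → -(Δ x : X) ∈ D) ∧
      ∀ d ∈ D, ∃ x : Metric.sphere (0 : lp (fun _ : Γ => ℂ) ∞) 1,
        (x : lp (fun _ : Γ => ℂ) ∞) t = c ∧ (Δ x : X) = d := by
  classical
  have hΔ : ∀ x, ‖(Δ x : X)‖ = 1 := fun x => mem_sphere_zero_iff_norm.1 (Δ x).2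
  let e : Metric.sphere (0 : lp (fun _ : Γ => ℂ) ∞) 1 :=
    ⟨lp.single ∞ t (-c), by
      rw [mem_sphere_zero_iff_norm, lp.norm_single (by simp), norm_neg, hc]⟩
  obtain ⟨D, hconv, hD1, hDp, hmax⟩ :=
    exists_convex_subset_sphere (p := -(Δ e : X)) (by rw [norm_neg, hΔ])
  have hface : ∀ d ∈ D, ∃ x : Metric.sphere (0 : lp (fun _ : Γ => ℂ) ∞) 1,
        (x : lp (fun _ : Γ => ℂ) ∞) t = c ∧ (Δ x : X) = d := by
    intro d hd
    obtain ⟨x, hx⟩ := hsurj ⟨d, mem_sphere_zero_iff_norm.2 (hD1 d hd)⟩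
    have hx : (Δ x : X) = d := congrArg Subtype.val hx
    refine ⟨x, lp.apply_eq_of_norm_sub_single (mem_sphere_zero_iff_norm.1 x.2).le hc ?_, hx⟩
    have := hDp d hd
    rwa [← hx, ← sub_eq_add_neg, hiso] at this
  refine ⟨D, hconv, hD1, fun x hx => ?_, hface⟩
  refine hmax _ (by rw [norm_neg, hΔ]) fun d hd => ?_
  obtain ⟨y, hy, rfl⟩ := hface d hd
  refine le_antisymm ((norm_add_le _ _).trans ?_) ?_
  · rw [norm_neg, hΔ, hΔ]; norm_num
  · rw [← sub_eq_add_neg, hiso]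
    have h := lp.norm_apply_le_norm ENNReal.top_ne_zero
      ((y : lp (fun _ : Γ => ℂ) ∞) - (x : lp (fun _ : Γ => ℂ) ∞)) t
    rw [lp.coeFn_sub, Pi.sub_apply, hx, hy, sub_neg_eq_add, ← two_mul, norm_mul, hc] at h
    simpa using h

/-- The image under `Δ` of the face `{x | x t = c}` is normed by a functional that vanishes on
`Δ x` whenever `x t = 0`. -/
theorem exists_dual_face (hsurj : Function.Surjective Δ)
    (hiso : ∀ u v, ‖(Δ u : X) - (Δ v : X)‖ =
      ‖(u : lp (fun _ : Γ => ℂ) ∞) - (v : lp (fun _ : Γ => ℂ) ∞)‖)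
    (t : Γ) {c : ℂ} (hc : ‖c‖ = 1) :
    ∃ φ : X →ₗ[ℂ] ℂ, (∀ y, ‖φ y‖ ≤ ‖y‖) ∧
      (∀ x : Metric.sphere (0 : lp (fun _ : Γ => ℂ) ∞) 1,
        (x : lp (fun _ : Γ => ℂ) ∞) t = c → φ (Δ x) = 1) ∧
      ∀ x : Metric.sphere (0 : lp (fun _ : Γ => ℂ) ∞) 1,
        (x : lp (fun _ : Γ => ℂ) ∞) t = 0 → φ (Δ x) = 0 := by
  have hc' : ‖-c‖ = 1 := by rwa [norm_neg]
  obtain ⟨D, hconv, hD1, hneg, -⟩ := exists_convex_between_faces hsurj hiso t hc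
  obtain ⟨D', -, -, hneg', hface'⟩ := exists_convex_between_faces hsurj hiso t hc'
  obtain ⟨φ, hφ, hφD⟩ := exists_dual_eq_one_of_convex hconv hD1
  have hpos : ∀ x : Metric.sphere (0 : lp (fun _ : Γ => ℂ) ∞) 1,
        (x : lp (fun _ : Γ => ℂ) ∞) t = c → φ (Δ x) = 1 := by
    intro x hx
    obtain ⟨y, hy, hyx⟩ := hface' _ (hneg' x (by rw [hx, neg_neg]))
    have := hφD _ (hneg y hy)
    rwa [hyx, neg_neg] at this
  refine ⟨φ, hφ, hpos, fun x hx => ?_⟩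
  have hx1 := (mem_sphere_zero_iff_norm.1 x.2).le
  obtain ⟨y, hy, hyx⟩ := lp.exists_mem_sphere_apply_eq hx1 t hc
  obtain ⟨z, hz, hzx⟩ := lp.exists_mem_sphere_apply_eq hx1 t hc'
  have h1 := hφ (Δ y - Δ x)
  rw [hiso, hyx, map_sub, hpos y hy, hx, sub_zero, hc] at h1
  have h2 := hφ (Δ z - Δ x)
  have hz' : φ (Δ z) = -1 := by
    rw [← hφD _ (hneg z hz), map_neg, neg_neg]
  rw [hiso, hzx, map_sub, hz', hx, sub_zero, hc', ← neg_add', norm_neg] at h2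
  have h3 := parallelogram_law_with_norm ℝ 1 (φ (Δ x))
  have h4 : ‖φ (Δ x)‖ = 0 := by
    have h5 := norm_nonneg (1 - φ (Δ x))
    have h6 := norm_nonneg (1 + φ (Δ x))
    rw [norm_one] at h3
    exact pow_eq_zero_iff two_ne_zero |>.1 (le_antisymm (by nlinarith) (sq_nonneg _))
  exact norm_eq_zero.1 h4

/-- The norm of `X` is determined by the contractive functionals that vanish, for some `t`, on
`Δ x` whenever `x t = 0`. -/
theorem norm_le_of_forall_dual_face (hsurj : Function.Surjective Δ)
    (hiso : ∀ u v, ‖(Δ u : X) - (Δ v : X)‖ =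
      ‖(u : lp (fun _ : Γ => ℂ) ∞) - (v : lp (fun _ : Γ => ℂ) ∞)‖)
    {y : X} {M : ℝ} (hM : 0 ≤ M)
    (h : ∀ (t : Γ) (φ : X →ₗ[ℂ] ℂ), (∀ z, ‖φ z‖ ≤ ‖z‖) →
      (∀ x : Metric.sphere (0 : lp (fun _ : Γ => ℂ) ∞) 1,
        (x : lp (fun _ : Γ => ℂ) ∞) t = 0 → φ (Δ x) = 0) → ‖φ y‖ ≤ M) :
    ‖y‖ ≤ M := by
  rcases eq_or_ne y 0 with rfl | hy
  · simpa using hM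
  have hy0 : 0 < ‖y‖ := norm_pos_iff.2 hy
  obtain ⟨x, hx⟩ := hsurj ⟨((‖y‖⁻¹ : ℝ) : ℂ) • y, by
    rw [mem_sphere_zero_iff_norm, norm_smul, Complex.norm_real, norm_inv, norm_norm,
      inv_mul_cancel₀ hy0.ne']⟩
  have hx : (Δ x : X) = ((‖y‖⁻¹ : ℝ) : ℂ) • y := congrArg Subtype.val hx
  have hx1 : ‖(x : lp (fun _ : Γ => ℂ) ∞)‖ = 1 := mem_sphere_zero_iff_norm.1 x.2
  have hcoord : ∀ t, ‖(x : lp (fun _ : Γ => ℂ) ∞) t‖ ≤ M / ‖y‖ := by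
    intro t
    set a := (x : lp (fun _ : Γ => ℂ) ∞) t with ha
    rcases eq_or_ne a 0 with h0 | h0
    · rw [h0, norm_zero]; positivity
    have hn : ‖a‖ ≠ 0 := norm_ne_zero_iff.2 h0
    have ha1 : ‖a‖ ≤ 1 := (lp.norm_apply_le_norm ENNReal.top_ne_zero _ t).trans hx1.le
    have hc : ‖a / ‖a‖‖ = 1 := by
      rw [norm_div, Complex.norm_real, norm_norm, div_self hn]
    obtain ⟨φ, hφ, hφ1, hφ0⟩ := exists_dual_face hsurj hiso t hc
    obtain ⟨z, hz, hzx⟩ := lp.exists_mem_sphere_apply_eq hx1.le t hc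
    have hdist : ‖a / ‖a‖ - a‖ = 1 - ‖a‖ := by
      have hn' : (‖a‖ : ℂ) ≠ 0 := by exact_mod_cast hn
      have : a / ‖a‖ - a = (a / ‖a‖) * ((1 - ‖a‖ : ℝ) : ℂ) := by
        push_cast
        field_simp
      rw [this, norm_mul, hc, one_mul, Complex.norm_real, Real.norm_of_nonneg (by linarith)]
    have h1 := hφ (Δ z - Δ x)
    rw [hiso, hzx, ← ha, hdist, map_sub, hφ1 z hz] at h1
    have h2 := norm_sub_norm_le 1 (φ (Δ x))
    rw [norm_one] at h2
    have h3 : ‖φ (Δ x)‖ = ‖φ y‖ / ‖y‖ := by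
      rw [hx, map_smul, norm_smul, Complex.norm_real, norm_inv, norm_norm, inv_mul_eq_div]
    have h4 : ‖φ y‖ / ‖y‖ ≤ M / ‖y‖ := by
      gcongr
      exact h t φ hφ hφ0
    linarith
  have := lp.norm_le_of_forall_le (by positivity) hcoord
  rwa [hx1, le_div_iff₀ hy0, one_mul] at this

end SphereIsometry

theorem stmt14 {Γ : Type*} [Infinite Γ] {X : Type*} [NormedAddCommGroup X]
    [NormedSpace ℂ X] [CompleteSpace X]
    (Δ : Metric.sphere (0 : lp (fun _ : Γ => ℂ) ∞) 1 → Metric.sphere (0 : X) 1)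
    (hsurj : Function.Surjective Δ)
    (hiso : ∀ u v, ‖(Δ u : X) - (Δ v : X)‖ =
      ‖(u : lp (fun _ : Γ => ℂ) ∞) - (v : lp (fun _ : Γ => ℂ) ∞)‖)
    (k : ℕ) (v : Fin (k + 1) → lp (fun _ : Γ => ℂ) ∞)
    (hpi : ∀ j m, ‖v j m‖ = 0 ∨ ‖v j m‖ = 1)
    (hne : ∀ j, v j ≠ 0)
    (horth : ∀ i j, i ≠ j → ∀ m, v i m * v j m = 0)
    (hv1 : ∀ j, v j ∈ Metric.sphere (0 : lp (fun _ : Γ => ℂ) ∞) 1) :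
    ∀ α : Fin (k + 1) → ℂ,
      ‖∑ j, α j • (Δ ⟨v j, hv1 j⟩ : X)‖ =
        Finset.univ.sup' Finset.univ_nonempty (fun j => ‖α j‖) := by
  intro α
  have hsum : ∀ (t : Γ) (j : Fin (k + 1)) (φ : X →ₗ[ℂ] ℂ),
      (∀ x : Metric.sphere (0 : lp (fun _ : Γ => ℂ) ∞) 1,
        (x : lp (fun _ : Γ => ℂ) ∞) t = 0 → φ (Δ x) = 0) → v j t ≠ 0 →
      φ (∑ i, α i • (Δ ⟨v i, hv1 i⟩ : X)) = α j * φ (Δ ⟨v j, hv1 j⟩) := by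
    intro t j φ hφ hj
    rw [map_sum, Finset.sum_eq_single j]
    · rw [map_smul, smul_eq_mul]
    · intro i _ hij
      rw [map_smul, hφ _ ((mul_eq_zero.1 (horth i j hij t)).resolve_right hj), smul_zero]
    · simp
  have hle : ∀ j, ‖α j‖ ≤ Finset.univ.sup' Finset.univ_nonempty (fun j => ‖α j‖) :=
    fun j => Finset.le_sup' (fun j => ‖α j‖) (Finset.mem_univ j)
  have h0 := (norm_nonneg (α 0)).trans (hle 0)
  refine le_antisymm (norm_le_of_forall_dual_face hsurj hiso h0 fun t φ hφ hφ0 => ?_)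
    (Finset.sup'_le _ _ fun j _ => ?_)
  · by_cases hj : ∃ j, v j t ≠ 0
    · obtain ⟨j, hj⟩ := hj
      rw [hsum t j φ hφ0 hj, norm_mul]
      have h1 := hφ (Δ ⟨v j, hv1 j⟩)
      rw [mem_sphere_zero_iff_norm.1 (Δ ⟨v j, hv1 j⟩).2] at h1
      exact (mul_le_of_le_one_right (norm_nonneg _) h1).trans (hle j)
    · push Not at hj
      rw [map_sum, Finset.sum_eq_zero, norm_zero]
      · exact h0
      · intro i _
        rw [map_smul, hφ0 _ (hj i), smul_zero]
  · obtain ⟨t, ht⟩ : ∃ t, v j t ≠ 0 := by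
      by_contra! hall
      exact hne j (lp.ext (funext hall))
    obtain ⟨φ, hφ, hφ1, hφ0⟩ := exists_dual_face hsurj hiso t
      ((hpi j t).resolve_left (norm_ne_zero_iff.2 ht))
    have := hφ (∑ i, α i • (Δ ⟨v i, hv1 i⟩ : X))
    rwa [hsum t j φ hφ0 ht, hφ1 _ rfl, mul_one] at this
end

section
/- Let Γ be an infinite set, X a complex Banach space, Δ : S(ℓ∞(Γ)) → S(X) a surjective isometry, and v_1,...,v_k mutually orthogonal nonzero partial isometries. Then for all α_1,...,α_k ∈ ℂ \ {0} with max_j|α_j| = 1, ∑_{j=1}^k α_j Δ(v_j) = Δ(∑_{j=1}^k α_j ⊙ v_j). -/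
open scoped ENNReal

section FunctionalAnalysis

variable {X : Type*} [NormedAddCommGroup X] [NormedSpace ℂ X]

theorem Complex.eq_one_of_norm_le_one_of_one_le_re {z : ℂ} (h : ‖z‖ ≤ 1) (h' : 1 ≤ z.re) :
    z = 1 := by
  have h1 : z.re = 1 := le_antisymm ((Complex.re_le_norm z).trans h) h'
  have h2 : z.re * z.re + z.im * z.im ≤ 1 := by
    rw [← Complex.normSq_apply, Complex.normSq_eq_norm_sq]
    nlinarith [norm_nonneg z]
  have h3 : z.im = 0 := by
    rw [h1] at h2
    nlinarith
  exact Complex.ext h1 h3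

/-- Two points of the unit ball whose sum has norm `2` have a common norming functional. -/
theorem exists_common_norming_functional {u v : X} (hu : ‖u‖ ≤ 1) (hv : ‖v‖ ≤ 1)
    (huv : ‖u + v‖ = 2) : ∃ φ : StrongDual ℂ X, ‖φ‖ ≤ 1 ∧ φ u = 1 ∧ φ v = 1 := by
  obtain ⟨φ, hφ, h⟩ := exists_dual_vector'' ℂ (u + v)
  have hle : ∀ w : X, ‖w‖ ≤ 1 → ‖φ w‖ ≤ 1 := fun w hw => by
    simpa using φ.le_of_opNorm_le_of_le hφ hw
  have hre : (φ u).re + (φ v).re = 2 := by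
    rw [map_add, huv] at h
    simpa using congrArg Complex.re h
  have h1 := (Complex.re_le_norm (φ u)).trans (hle u hu)
  have h2 := (Complex.re_le_norm (φ v)).trans (hle v hv)
  exact ⟨φ, hφ, Complex.eq_one_of_norm_le_one_of_one_le_re (hle u hu) (by linarith),
    Complex.eq_one_of_norm_le_one_of_one_le_re (hle v hv) (by linarith)⟩

theorem norm_eq_one_of_functional_eq_one {φ : StrongDual ℂ X} (hφ : ‖φ‖ ≤ 1) {w : X}
    (hw : φ w = 1) : 1 ≤ ‖w‖ := by
  simpa [hw] using φ.le_of_opNorm_le hφ w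

/-- A convex subset of the unit sphere is normed by a single functional. -/
theorem exists_norming_functional_of_convex {C : Set X} (hC : Convex ℝ C)
    (hsph : ∀ z ∈ C, ‖z‖ = 1) :
    ∃ φ : StrongDual ℂ X, ‖φ‖ ≤ 1 ∧ ∀ z ∈ C, φ z = 1 := by
  have hdisj : Disjoint (Metric.ball (0 : X) 1) C := by
    rw [Set.disjoint_left]
    intro z hz hzC
    simp [hsph z hzC] at hz
  obtain ⟨f, u, hlt, hge⟩ := RCLike.geometric_hahn_banach_open (𝕜 := ℂ)
    (convex_ball (0 : X) 1) Metric.isOpen_ball hC hdisj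
  have hu : 0 < u := by simpa using hlt 0 (by simp)
  have hball : ∀ y : X, ‖y‖ < 1 → ‖f y‖ ≤ u := by
    intro y hy
    obtain ⟨c, hc, hcf⟩ : ∃ c : ℂ, ‖c‖ = 1 ∧ ↑‖f y‖ = c * f y :=
      RCLike.exists_norm_eq_mul_self (f y)
    have := hlt (c • y) (by simpa [norm_smul, hc] using hy)
    rw [map_smul, smul_eq_mul, ← hcf] at this
    simpa using this.le
  have hf : ∀ y : X, ‖f y‖ ≤ u * ‖y‖ := by
    intro y
    refine le_of_forall_gt_imp_ge_of_dense fun b hb => ?_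
    have hr : ‖y‖ < b / u := by rw [lt_div_iff₀ hu]; linarith
    have hr0 : 0 < b / u := (norm_nonneg y).trans_lt hr
    have h1 : ‖f (((b / u : ℝ) : ℂ)⁻¹ • y)‖ ≤ u := by
      apply hball
      rw [norm_smul, norm_inv, Complex.norm_of_nonneg hr0.le, inv_mul_lt_iff₀ hr0, mul_one]
      exact hr
    rw [map_smul, norm_smul, norm_inv, Complex.norm_of_nonneg hr0.le, inv_mul_le_iff₀ hr0,
      div_mul_cancel₀ _ hu.ne'] at h1
    exact h1
  have hφ : ∀ y : X, ‖((u : ℂ)⁻¹ • f) y‖ ≤ 1 * ‖y‖ := by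
    intro y
    rw [_root_.smul_apply, norm_smul, norm_inv, Complex.norm_of_nonneg hu.le,
      inv_mul_le_iff₀ hu, one_mul]
    exact hf y
  refine ⟨(u : ℂ)⁻¹ • f, ContinuousLinearMap.opNorm_le_bound _ zero_le_one hφ, fun z hz => ?_⟩
  refine Complex.eq_one_of_norm_le_one_of_one_le_re (by simpa [hsph z hz] using hφ z) ?_
  have h2 : (((u : ℂ)⁻¹ • f) z).re = u⁻¹ * (f z).re := by
    rw [_root_.smul_apply, smul_eq_mul, ← Complex.ofReal_inv, Complex.re_ofReal_mul]
  rw [h2, le_inv_mul_iff₀ hu, mul_one]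
  exact hge z hz

/-- If all pairs in the star `{z : ‖z‖ = 1, ‖z + x‖ = 2}` of `x` have sums of norm `2`, then the
whole star is normed by a single functional. -/
theorem exists_norming_functional_star {x : X} (hx : ‖x‖ = 1)
    (hpair : ∀ z w : X, ‖z‖ = 1 → ‖w‖ = 1 → ‖z + x‖ = 2 → ‖w + x‖ = 2 → ‖z + w‖ = 2) :
    ∃ φ : StrongDual ℂ X, ‖φ‖ ≤ 1 ∧ ∀ z : X, ‖z‖ = 1 → ‖z + x‖ = 2 → φ z = 1 := by
  have hmem : ∀ (φ : StrongDual ℂ X) (z : X), ‖φ‖ ≤ 1 → ‖z‖ ≤ 1 → φ z = 1 → φ x = 1 →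
      ‖z‖ = 1 ∧ ‖z + x‖ = 2 := by
    intro φ z hφ hz hφz hφx
    refine ⟨le_antisymm hz (norm_eq_one_of_functional_eq_one hφ hφz), le_antisymm ?_ ?_⟩
    · linarith [norm_add_le z x]
    · have := φ.le_of_opNorm_le hφ (z + x)
      rw [map_add, hφz, hφx] at this
      norm_num at this
      exact this
  have hconv : Convex ℝ {z : X | ‖z‖ = 1 ∧ ‖z + x‖ = 2} := by
    rintro z ⟨hz, hzx⟩ w ⟨hw, hwx⟩ a b ha hb hab
    have hle : ∀ (a b : ℝ) (p q : X), 0 ≤ a → 0 ≤ b → a + b = 1 → ‖p‖ = 1 → ‖q‖ = 1 →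
        ‖a • p + b • q‖ ≤ 1 := by
      intro a b p q ha hb hab hp hq
      refine (norm_add_le _ _).trans ?_
      rw [norm_smul, norm_smul, hp, hq, Real.norm_of_nonneg ha, Real.norm_of_nonneg hb]
      linarith
    have hφsmul : ∀ (φ : StrongDual ℂ X) (a b : ℝ) (p q : X), φ (a • p + b • q) =
        a * φ p + b * φ q := by
      intro φ a b p q
      rw [← Complex.coe_smul, ← Complex.coe_smul, map_add, map_smul, map_smul, smul_eq_mul,
        smul_eq_mul]
    have hm := hle (1 / 2) (1 / 2) z x (by norm_num) (by norm_num) (by norm_num) hz hx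
    obtain ⟨φ, hφ, hφz, hφx⟩ := exists_common_norming_functional hz.le hx.le hzx
    have hmid := hmem φ _ hφ hm (by rw [hφsmul, hφz, hφx]; norm_num) hφx
    have hwm := hpair _ w hmid.1 hw hmid.2 hwx
    obtain ⟨ψ, hψ, hψm, hψw⟩ := exists_common_norming_functional hm hw.le hwm
    have hψle : ∀ p : X, ‖p‖ = 1 → (ψ p).re ≤ 1 := fun p hp =>
      (Complex.re_le_norm _).trans (by simpa [hp] using ψ.le_of_opNorm_le hψ p)
    have hsum : (ψ z).re + (ψ x).re = 2 := by
      rw [hφsmul] at hψm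
      have := congrArg Complex.re hψm
      rw [Complex.add_re, Complex.re_ofReal_mul, Complex.re_ofReal_mul, Complex.one_re] at this
      linarith
    have hnle : ∀ p : X, ‖p‖ = 1 → ‖ψ p‖ ≤ 1 := fun p hp => by
      simpa [hp] using ψ.le_of_opNorm_le hψ p
    have hψz : ψ z = 1 := Complex.eq_one_of_norm_le_one_of_one_le_re (hnle z hz)
      (by linarith [hψle x hx])
    have hψx : ψ x = 1 := Complex.eq_one_of_norm_le_one_of_one_le_re (hnle x hx)
      (by linarith [hψle z hz])
    refine hmem ψ _ hψ (hle a b z w ha hb hab hz hw) ?_ hψx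
    rw [hφsmul, hψz, hψw, mul_one, mul_one]
    exact_mod_cast hab
  obtain ⟨φ, hφ, h⟩ := exists_norming_functional_of_convex hconv fun z hz => hz.1
  exact ⟨φ, hφ, fun z h1 h2 => h z ⟨h1, h2⟩⟩

end FunctionalAnalysis

/-- A point of the closed unit disc is determined by its distances to the unit circle. -/
theorem Complex.eq_of_forall_norm_sub_le {s t : ℂ} (hs : ‖s‖ ≤ 1) (ht : ‖t‖ ≤ 1)
    (h : ∀ μ : ℂ, ‖μ‖ = 1 → ‖μ - t‖ ≤ ‖μ - s‖) : t = s := by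
  by_contra hne
  have hd : 0 < ‖s - t‖ := norm_pos_iff.2 (sub_ne_zero.2 (Ne.symm hne))
  have hexp : ∀ z : ℂ, ‖(s - t) - (‖s - t‖ : ℂ) * z‖ = ‖s - t‖ * ‖(s - t) / ‖s - t‖ - z‖ := by
    intro z
    have hd' : (‖s - t‖ : ℂ) ≠ 0 := by exact_mod_cast hd.ne'
    rw [← Complex.norm_of_nonneg hd.le, ← norm_mul, mul_sub, Complex.norm_of_nonneg hd.le,
      mul_div_cancel₀ _ hd']
  have hμ := h ((s - t) / ‖s - t‖) (by
    rw [norm_div, Complex.norm_of_nonneg hd.le, div_self hd.ne'])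
  have h1 := mul_le_mul_of_nonneg_left hμ hd.le
  rw [← hexp, ← hexp] at h1
  have h2 := pow_le_pow_left₀ (norm_nonneg _) h1 2
  have hst : ‖s‖ - ‖t‖ ≤ ‖s - t‖ := norm_sub_norm_le s t
  set r := ‖s - t‖ with hr
  have hr2 : r ^ 2 = (s.re - t.re) ^ 2 + (s.im - t.im) ^ 2 := by
    rw [hr, ← Complex.normSq_eq_norm_sq, Complex.normSq_apply, Complex.sub_re, Complex.sub_im]
    ring
  have hs2 : ‖s‖ ^ 2 = s.re ^ 2 + s.im ^ 2 := by
    rw [← Complex.normSq_eq_norm_sq, Complex.normSq_apply]; ring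
  have ht2 : ‖t‖ ^ 2 = t.re ^ 2 + t.im ^ 2 := by
    rw [← Complex.normSq_eq_norm_sq, Complex.normSq_apply]; ring
  rw [← Complex.normSq_eq_norm_sq, ← Complex.normSq_eq_norm_sq, Complex.normSq_apply,
    Complex.normSq_apply] at h2
  simp only [Complex.sub_re, Complex.sub_im, Complex.re_ofReal_mul, Complex.im_ofReal_mul] at h2
  have h3 : r ^ 2 * (2 * r) ≤ r ^ 2 * (‖s‖ ^ 2 - ‖t‖ ^ 2) := by
    have e : r * (2 * r ^ 2) ≤ r * (r * (‖s‖ ^ 2 - ‖t‖ ^ 2)) := by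
      rw [hs2, ht2]
      linear_combination h2 + 2 * r * hr2
    nlinarith
  have h4 : 2 * r ≤ ‖s‖ ^ 2 - ‖t‖ ^ 2 := le_of_mul_le_mul_left h3 (by positivity)
  have h5 : ‖s‖ = 1 ∧ ‖t‖ = 1 := by
    have : (2 - (‖s‖ + ‖t‖)) * r ≤ 0 := by nlinarith [norm_nonneg s, norm_nonneg t]
    have : 2 - (‖s‖ + ‖t‖) ≤ 0 := nonpos_of_mul_nonpos_left this hd
    constructor <;> linarith
  rw [h5.1, h5.2] at h4
  linarith

section SupNorm

variable {Γ : Type*} [DecidableEq Γ]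

/-- The bounded function with value `c` at `k` and `0` elsewhere. -/
noncomputable def lp.coordSingle (k : Γ) (c : ℂ) : lp (fun _ : Γ => ℂ) ∞ :=
  lp.single (E := fun _ : Γ => ℂ) ∞ k c

theorem lp.coordSingle_apply_self (k : Γ) (c : ℂ) : lp.coordSingle k c k = c :=
  lp.single_apply_self (E := fun _ : Γ => ℂ) ∞ k c

theorem lp.coordSingle_apply_ne (k : Γ) (c : ℂ) {m : Γ} (hm : m ≠ k) : lp.coordSingle k c m = 0 :=
  lp.single_apply_ne (E := fun _ : Γ => ℂ) ∞ k c hm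

theorem lp.norm_coordSingle (k : Γ) (c : ℂ) : ‖lp.coordSingle k c‖ = ‖c‖ :=
  lp.norm_single (E := fun _ : Γ => ℂ) (by simp) k c

theorem lp.coordSingle_neg (k : Γ) (c : ℂ) : lp.coordSingle k (-c) = -lp.coordSingle k c :=
  lp.single_neg (E := fun _ : Γ => ℂ) ∞ k c

theorem lp.coordSingle_eq_smul (k : Γ) (c : ℂ) : lp.coordSingle k c = c • lp.coordSingle k 1 := by
  have := lp.single_smul (E := fun _ : Γ => ℂ) (𝕜 := ℂ) ∞ k c 1
  rwa [smul_eq_mul, mul_one] at this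

theorem lp.norm_add_single_eq_two_iff {y : lp (fun _ : Γ => ℂ) ∞} (hy : ‖y‖ = 1) (k : Γ) {c : ℂ}
    (hc : ‖c‖ = 1) : ‖y + lp.coordSingle k c‖ = 2 ↔ y k = c := by
  have hyk := lp.norm_apply_le_norm ENNReal.top_ne_zero y
  have hval : (y + lp.coordSingle k c) k = y k + c := by
    rw [lp.coeFn_add, Pi.add_apply, lp.coordSingle_apply_self]
  constructor
  · intro h
    by_contra hne
    have hlt : ‖y k + c‖ < 2 := by
      have hpar := parallelogram_law_with_norm ℝ (y k) c
      have hpos : 0 < ‖y k - c‖ := norm_pos_iff.2 (sub_ne_zero.2 hne)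
      have := hyk k
      nlinarith [norm_nonneg (y k), norm_nonneg (y k + c)]
    have hle : ‖y + lp.coordSingle k c‖ ≤ max ‖y k + c‖ 1 := by
      refine lp.norm_le_of_forall_le (by positivity) fun m => ?_
      rcases eq_or_ne m k with rfl | hm
      · rw [hval]
        exact le_max_left _ _
      · rw [lp.coeFn_add, Pi.add_apply, lp.coordSingle_apply_ne k c hm, add_zero]
        exact ((hyk m).trans hy.le).trans (le_max_right _ _)
    rw [h] at hle
    exact absurd hle (not_le.2 (max_lt hlt (by norm_num)))
  · intro h
    refine le_antisymm ?_ ?_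
    · refine (norm_add_le _ _).trans ?_
      rw [hy, lp.norm_coordSingle, hc]
      norm_num
    · have := lp.norm_apply_le_norm ENNReal.top_ne_zero (y + lp.coordSingle k c) k
      rw [hval, h, ← two_mul, norm_mul, hc] at this
      simpa using this

/-- Every unit vector is at distance `‖c - a k‖` from some unit vector with `k`-th coordinate
the unimodular number `c`. -/
theorem lp.exists_apply_eq_norm_sub_le {a : lp (fun _ : Γ => ℂ) ∞} (ha : ‖a‖ = 1) (k : Γ) {c : ℂ}
    (hc : ‖c‖ = 1) :
    ∃ b : lp (fun _ : Γ => ℂ) ∞, ‖b‖ = 1 ∧ b k = c ∧ ‖b - a‖ ≤ ‖c - a k‖ := by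
  have hval : (a + lp.coordSingle k (c - a k)) k = c := by
    rw [lp.coeFn_add, Pi.add_apply, lp.coordSingle_apply_self]
    ring
  refine ⟨a + lp.coordSingle k (c - a k), le_antisymm ?_ ?_, hval, ?_⟩
  · refine lp.norm_le_of_forall_le zero_le_one fun m => ?_
    rcases eq_or_ne m k with rfl | hm
    · rw [hval, hc]
    · rw [lp.coeFn_add, Pi.add_apply, lp.coordSingle_apply_ne k _ hm, add_zero]
      exact (lp.norm_apply_le_norm ENNReal.top_ne_zero a m).trans ha.le
  · have := lp.norm_apply_le_norm ENNReal.top_ne_zero (a + lp.coordSingle k (c - a k)) k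
    rwa [hval, hc] at this
  · rw [add_sub_cancel_left, lp.norm_coordSingle]

end SupNorm

/-- A surjective isometry of unit spheres that acts on the multiples of the `k`-th unit vector as
the identity or the conjugation `τ` is, followed by a suitable functional, equal to `τ` of the
`k`-th coordinate. -/
theorem exists_coordinate_functional {Γ : Type*} [DecidableEq Γ] {X : Type*}
    [NormedAddCommGroup X] [NormedSpace ℂ X]
    (Δ : Metric.sphere (0 : lp (fun _ : Γ => ℂ) ∞) 1 → Metric.sphere (0 : X) 1)
    (hsurj : Function.Surjective Δ)
    (hiso : ∀ u v, ‖(Δ u : X) - (Δ v : X)‖ =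
      ‖(u : lp (fun _ : Γ => ℂ) ∞) - (v : lp (fun _ : Γ => ℂ) ∞)‖)
    (k : Γ) (τ : ℂ → ℂ) (hτ : τ = id ∨ τ = starRingEnd ℂ)
    (x : X) (hx : ‖x‖ = 1)
    (hΔ : ∀ (u : Metric.sphere (0 : lp (fun _ : Γ => ℂ) ∞) 1) (c : ℂ), ‖c‖ = 1 →
      (u : lp (fun _ : Γ => ℂ) ∞) = lp.coordSingle k c →
      (Δ u : X) = τ c • x) :
    ∃ φ : StrongDual ℂ X, ∀ a, φ (Δ a : X) = τ ((a : lp (fun _ : Γ => ℂ) ∞) k) := by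
  have hnorm : ∀ c, ‖τ c‖ = ‖c‖ := by rcases hτ with rfl | rfl <;> simp
  have hneg : ∀ c, τ (-c) = -τ c := by rcases hτ with rfl | rfl <;> simp
  have hsub : ∀ c d, τ c - τ d = τ (c - d) := by rcases hτ with rfl | rfl <;> simp
  have hinv : ∀ c, τ (τ c) = c := by rcases hτ with rfl | rfl <;> simp
  have hone : τ 1 = 1 := by rcases hτ with rfl | rfl <;> simp
  have hΔ1 : ∀ u, ‖(Δ u : X)‖ = 1 := fun u => by simp
  have hn1 : ∀ u : Metric.sphere (0 : lp (fun _ : Γ => ℂ) ∞) 1,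
      ‖(u : lp (fun _ : Γ => ℂ) ∞)‖ = 1 := fun u => by simp
  have hface : ∀ u (c : ℂ), ‖c‖ = 1 →
      (‖(Δ u : X) + τ c • x‖ = 2 ↔ (u : lp (fun _ : Γ => ℂ) ∞) k = c) := by
    intro u c hc
    have hmem : lp.coordSingle k (-c) ∈ Metric.sphere (0 : lp (fun _ : Γ => ℂ) ∞) 1 := by
      rw [mem_sphere_zero_iff_norm, lp.norm_coordSingle, norm_neg, hc]
    have h1 := hiso u ⟨lp.coordSingle k (-c), hmem⟩
    rw [hΔ ⟨lp.coordSingle k (-c), hmem⟩ (-c) (by rwa [norm_neg]) rfl, hneg, neg_smul, sub_neg_eq_add] at h1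
    rw [h1]
    change ‖(u : lp (fun _ : Γ => ℂ) ∞) - lp.coordSingle k (-c)‖ = 2 ↔ _
    rw [lp.coordSingle_neg, sub_neg_eq_add]
    exact lp.norm_add_single_eq_two_iff (hn1 u) k hc
  have hface1 : ∀ u, ‖(Δ u : X) + x‖ = 2 ↔ (u : lp (fun _ : Γ => ℂ) ∞) k = 1 := by
    intro u
    simpa [hone] using hface u 1 (by simp)
  obtain ⟨φ, hφ, hφ1⟩ := exists_norming_functional_star hx (by
    intro z w hz hw hzx hwx
    obtain ⟨a, ha⟩ := hsurj ⟨z, by simpa using hz⟩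
    obtain ⟨b, hb⟩ := hsurj ⟨-w, by simpa using hw⟩
    have ha' : (Δ a : X) = z := by rw [ha]
    have hb' : (Δ b : X) = -w := by rw [hb]
    have hak : (a : lp (fun _ : Γ => ℂ) ∞) k = 1 := by rw [← hface1, ha', hzx]
    have hbk : (b : lp (fun _ : Γ => ℂ) ∞) k = -1 := by
      rw [← hface b (-1) (by simp), hb', hneg, hone, neg_smul, one_smul, ← neg_add, norm_neg, hwx]
    have h := hiso a b
    rw [ha', hb', sub_neg_eq_add] at h
    rw [h]
    refine le_antisymm ?_ ?_
    · refine (norm_sub_le _ _).trans ?_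
      rw [hn1, hn1]
      norm_num
    · have := lp.norm_apply_le_norm ENNReal.top_ne_zero
        ((a : lp (fun _ : Γ => ℂ) ∞) - (b : lp (fun _ : Γ => ℂ) ∞)) k
      rw [lp.coeFn_sub, Pi.sub_apply, hak, hbk] at this
      norm_num at this
      exact this)
  have hunim : ∀ (u : Metric.sphere (0 : lp (fun _ : Γ => ℂ) ∞) 1) (c : ℂ), ‖c‖ = 1 →
      (u : lp (fun _ : Γ => ℂ) ∞) k = c → φ (Δ u : X) = τ c := by
    intro u c hc hu
    have hτc : τ c ≠ 0 := by
      rw [← norm_ne_zero_iff, hnorm, hc]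
      exact one_ne_zero
    have h2 := (hface u c hc).2 hu
    have h3 := hφ1 ((τ c)⁻¹ • (Δ u : X)) (by rw [norm_smul, norm_inv, hnorm, hc, hΔ1]; simp) (by
      rw [← h2]
      have : (Δ u : X) + τ c • x = τ c • ((τ c)⁻¹ • (Δ u : X) + x) := by
        rw [smul_add, smul_inv_smul₀ hτc]
      rw [this, norm_smul, hnorm, hc, one_mul])
    rw [map_smul, smul_eq_mul, inv_mul_eq_one₀ hτc] at h3
    exact h3.symm
  refine ⟨φ, fun a => ?_⟩
  refine Complex.eq_of_forall_norm_sub_le ?_ ?_ fun μ hμ => ?_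
  · rw [hnorm]
    exact (lp.norm_apply_le_norm ENNReal.top_ne_zero _ k).trans (hn1 a).le
  · simpa [hΔ1] using φ.le_of_opNorm_le hφ (Δ a : X)
  · have hμ' : ‖τ μ‖ = 1 := by rw [hnorm, hμ]
    obtain ⟨b, hb, hbk, hba⟩ := lp.exists_apply_eq_norm_sub_le (hn1 a) k hμ'
    have h4 := hunim ⟨b, by simpa using hb⟩ (τ μ) hμ' hbk
    rw [hinv] at h4
    have h5 := φ.le_of_opNorm_le hφ ((Δ ⟨b, by simpa using hb⟩ : X) - (Δ a : X))
    rw [map_sub, h4, one_mul, hiso] at h5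
    refine (h5.trans hba).trans ?_
    rw [← hnorm, ← hsub, hinv]

theorem stmt15 {Γ : Type*} [Infinite Γ] [DecidableEq Γ] {X : Type*} [NormedAddCommGroup X]
    [NormedSpace ℂ X] [CompleteSpace X]
    (Δ : Metric.sphere (0 : lp (fun _ : Γ => ℂ) ∞) 1 → Metric.sphere (0 : X) 1)
    (hsurj : Function.Surjective Δ)
    (hiso : ∀ u v, ‖(Δ u : X) - (Δ v : X)‖ =
      ‖(u : lp (fun _ : Γ => ℂ) ∞) - (v : lp (fun _ : Γ => ℂ) ∞)‖)
    (σ : Γ → ℂ → ℂ) (hσ : ∀ k, σ k = id ∨ σ k = (starRingEnd ℂ))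
    (hσΔ : ∀ (k : Γ) (ek : lp (fun _ : Γ => ℂ) ∞),
      (∀ m, ek m = if m = k then 1 else 0) → ∀ lam : ℂ, ‖lam‖ = 1 →
      ∀ (h1 : ek ∈ Metric.sphere (0 : lp (fun _ : Γ => ℂ) ∞) 1)
        (h2 : lam • ek ∈ Metric.sphere (0 : lp (fun _ : Γ => ℂ) ∞) 1),
        (Δ ⟨lam • ek, h2⟩ : X) = σ k lam • (Δ ⟨ek, h1⟩ : X))
    (odot : ℂ → lp (fun _ : Γ => ℂ) ∞ → lp (fun _ : Γ => ℂ) ∞)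
    (hodot : ∀ α a m, odot α a m = σ m α * a m)
    (k : ℕ) (v : Fin (k + 1) → lp (fun _ : Γ => ℂ) ∞)
    (hpi : ∀ j m, ‖v j m‖ = 0 ∨ ‖v j m‖ = 1)
    (hne : ∀ j, v j ≠ 0)
    (horth : ∀ i j, i ≠ j → ∀ m, v i m * v j m = 0)
    (hv1 : ∀ j, v j ∈ Metric.sphere (0 : lp (fun _ : Γ => ℂ) ∞) 1)
    (α : Fin (k + 1) → ℂ) (hα : ∀ j, α j ≠ 0)
    (hmax : Finset.univ.sup' Finset.univ_nonempty (fun j => ‖α j‖) = 1)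
    (hs : (∑ j, odot (α j) (v j)) ∈ Metric.sphere (0 : lp (fun _ : Γ => ℂ) ∞) 1) :
    (∑ j, α j • (Δ ⟨v j, hv1 j⟩ : X)) = (Δ ⟨∑ j, odot (α j) (v j), hs⟩ : X) := by
  have hτ : ∀ m, ∀ c d, σ m (c * d) = σ m c * σ m d := by
    intro m
    rcases hσ m with h | h <;> simp [h]
  have hinv : ∀ m c, σ m (σ m c) = c := by
    intro m
    rcases hσ m with h | h <;> simp [h]
  have hzero : ∀ m, σ m 0 = 0 := by
    intro m
    rcases hσ m with h | h <;> simp [h]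
  have hsum : ∀ m (f : Fin (k + 1) → ℂ), σ m (∑ j, f j) = ∑ j, σ m (f j) := by
    intro m
    rcases hσ m with h | h <;> simp [h]
  have hcoord : ∀ m : Γ, ∃ φ : StrongDual ℂ X,
      ∀ a, φ (Δ a : X) = σ m ((a : lp (fun _ : Γ => ℂ) ∞) m) := by
    intro m
    have he : lp.coordSingle m 1 ∈ Metric.sphere (0 : lp (fun _ : Γ => ℂ) ∞) 1 := by
      rw [mem_sphere_zero_iff_norm, lp.norm_coordSingle, norm_one]
    refine exists_coordinate_functional Δ hsurj hiso m (σ m) (hσ m) (Δ ⟨_, he⟩ : X)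
      (by simp) ?_
    rintro ⟨u, hu⟩ c hc huc
    change u = lp.coordSingle m c at huc
    subst huc
    have hsm := lp.coordSingle_eq_smul m c
    have := hσΔ m (lp.coordSingle m 1) (fun n => Pi.single_apply m (1 : ℂ) n) c hc he (hsm ▸ hu)
    rw [← this]
    congr 2
    exact Subtype.ext hsm
  choose φ hφ using hcoord
  by_contra hne
  set d : X := (∑ j, α j • (Δ ⟨v j, hv1 j⟩ : X)) - (Δ ⟨∑ j, odot (α j) (v j), hs⟩ : X) with hd
  have hd0 : d ≠ 0 := sub_ne_zero.2 hne
  have hφd : ∀ m, φ m d = 0 := by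
    intro m
    rw [hd, map_sub, map_sum, hφ, sub_eq_zero, lp.coeFn_sum, Finset.sum_apply, hsum]
    refine Finset.sum_congr rfl fun j _ => ?_
    rw [map_smul, hφ, smul_eq_mul, hodot, hτ, hinv]
  obtain ⟨a, ha⟩ := hsurj ⟨((‖d‖ : ℂ)⁻¹) • d, by
    rw [mem_sphere_zero_iff_norm, norm_smul, norm_inv, Complex.norm_of_nonneg (norm_nonneg d),
      inv_mul_cancel₀ (norm_ne_zero_iff.2 hd0)]⟩
  have ha0 : (a : lp (fun _ : Γ => ℂ) ∞) = 0 := by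
    ext m
    have h := hφ m a
    rw [ha, map_smul, hφd, smul_zero] at h
    rw [← hinv m ((a : lp (fun _ : Γ => ℂ) ∞) m), ← h, hzero]
    rfl
  have ha1 := a.2
  rw [ha0] at ha1
  simp at ha1
end
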